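/- Let n ∈ ℕ and δ ∈ (0,1), set σ̃² = σ²/n and τ̃² = (σ²/n)·(1−δ)/δ, and for q ∈ (0,1) and x ∈ ℝ let μ̃_q(x) be the unique real number μ with F̃_μ(x) = 1−q, where F̃_μ is the conditional c.d.f. of X̃ given X̃+Ũ ∈ T with X̃ ~ N(μ, σ̃²) and Ũ ~ N(0, τ̃²) independent. Then for all x ∈ ℝ and all q₁, q₂ ∈ (0,1) with q₁ < q₂, one has μ̃_{q₂}(x) − μ̃_{q₁}(x) < (σ/√n)·(Φ⁻¹(q₂) − Φ⁻¹(q₁))·(1/√(1−δ)). -/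

import Mathlib

open MeasureTheory ProbabilityTheory Set Filter Topology

noncomputable def stdphi (x : ℝ) : ℝ := Real.exp (-(x ^ 2) / 2) / Real.sqrt (2 * Real.pi)

noncomputable def stdPhi (x : ℝ) : ℝ := ∫ t in Iic x, stdphi t

noncomputable def stdPhiInv : ℝ → ℝ := Function.invFun stdPhi

noncomputable def stdPhiE (c : EReal) (x s : ℝ) : ℝ :=
  if c = ⊤ then 1 else if c = ⊥ then 0 else stdPhi ((c.toReal - x) / s)

def truncOrdered {k : ℕ} (a b : Fin k → EReal) : Prop :=
  (∀ i, a i < b i) ∧ ∀ i j : Fin k, i < j → b i < a j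

def truncSet {k : ℕ} (a b : Fin k → EReal) : Set ℝ :=
  {x : ℝ | ∃ i, a i < (x : EReal) ∧ (x : EReal) < b i}

noncomputable def truncSum {k : ℕ} (a b : Fin k → EReal) (s x : ℝ) : ℝ :=
  ∑ i, (stdPhiE (b i) x s - stdPhiE (a i) x s)

noncomputable def condPDF {k : ℕ} (a b : Fin k → EReal) (σ τ μ x : ℝ) : ℝ :=
  (1 / σ) * stdphi ((x - μ) / σ) * truncSum a b τ x
    / truncSum a b (Real.sqrt (σ ^ 2 + τ ^ 2)) μ

noncomputable def Fmu {k : ℕ} (a b : Fin k → EReal) (σ τ μ x : ℝ) : ℝ :=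
  ∫ u in Iic x, condPDF a b σ τ μ u

/-- `G_μ(x,v) = Φ((x - (ρ²μ + (1-ρ²)v))/(σρ))` with `ρ² = τ²/(σ²+τ²)`. -/
noncomputable def Gfun (σ τ μ x v : ℝ) : ℝ :=
  stdPhi ((x - (τ ^ 2 / (σ ^ 2 + τ ^ 2) * μ + (1 - τ ^ 2 / (σ ^ 2 + τ ^ 2)) * v)) /
    (σ * Real.sqrt (τ ^ 2 / (σ ^ 2 + τ ^ 2))))

/-- `G_μ(x,v)` for an extended-real `v`, with the natural conventions at `±∞`. -/
noncomputable def GfunE (σ τ μ x : ℝ) (c : EReal) : ℝ :=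
  if c = ⊤ then 0 else if c = ⊥ then 1 else Gfun σ τ μ x c.toReal

/-- `h(v)` from Lemma `le_dmu_formula`. -/
noncomputable def hfun {k : ℕ} (a b : Fin k → EReal) (σ τ μ v : ℝ) : ℝ :=
  (1 / Real.sqrt (σ ^ 2 + τ ^ 2)) * stdphi ((v - μ) / Real.sqrt (σ ^ 2 + τ ^ 2)) /
    truncSum a b (Real.sqrt (σ ^ 2 + τ ^ 2)) μ

/-- `h(v)` for an extended-real `v`, with the convention `φ(±∞) = 0`. -/
noncomputable def hfunE {k : ℕ} (a b : Fin k → EReal) (σ τ μ : ℝ) (c : EReal) : ℝ :=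
  if c = ⊤ then 0 else if c = ⊥ then 0 else hfun a b σ τ μ c.toReal

/-- `l(x,v)` from Lemma `le_dens_dx`. -/
noncomputable def lfun {k : ℕ} (a b : Fin k → EReal) (τ x v : ℝ) : ℝ :=
  (1 / τ) * stdphi ((v - x) / τ) / truncSum a b τ x

/-- `l(x,v)` for an extended-real `v`, with the convention `φ(±∞) = 0`. -/
noncomputable def lfunE {k : ℕ} (a b : Fin k → EReal) (τ x : ℝ) (c : EReal) : ℝ :=
  if c = ⊤ then 0 else if c = ⊥ then 0 else lfun a b τ x c.toReal

/-- The function `B_μ(x)` from the proof of Proposition 1. -/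
noncomputable def Bfun {k : ℕ} (a b : Fin k → EReal) (σ τ μ x : ℝ) : ℝ :=
  Real.sqrt (τ ^ 2 / (σ ^ 2 + τ ^ 2)) / σ * stdphi (stdPhiInv (Fmu a b σ τ μ x))
    - condPDF a b σ τ μ x
    + ∑ i, (hfunE a b σ τ μ (b i) * (Fmu a b σ τ μ x - GfunE σ τ μ x (b i))
        - hfunE a b σ τ μ (a i) * (Fmu a b σ τ μ x - GfunE σ τ μ x (a i)))

section Density

variable {f : ℝ → ℝ}

theorem integral_Iic_hasDerivAt (hc : Continuous f) (hi : Integrable f) (x : ℝ) :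
    HasDerivAt (fun y => ∫ u in Iic y, f u) (f x) x := by
  have h : (fun y => ∫ u in Iic y, f u) =
      fun y => (∫ u in Iic (0 : ℝ), f u) + ∫ u in (0 : ℝ)..y, f u := by
    funext y
    rw [← intervalIntegral.integral_Iic_sub_Iic hi.integrableOn hi.integrableOn]
    ring
  rw [h]
  exact (intervalIntegral.integral_hasDerivAt_right (hc.intervalIntegrable _ _)
    (hc.stronglyMeasurableAtFilter _ _) hc.continuousAt).const_add _

theorem tendsto_integral_Iic_atTop (hi : Integrable f) :
    Tendsto (fun y => ∫ u in Iic y, f u) atTop (𝓝 (∫ u, f u)) :=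
  (aecover_Iic tendsto_id).integral_tendsto_of_countably_generated hi

theorem tendsto_integral_Iic_atBot (hi : Integrable f) :
    Tendsto (fun y => ∫ u in Iic y, f u) atBot (𝓝 0) := by
  have h : (fun y => ∫ u in Iic y, f u) = fun y => (∫ u, f u) - ∫ u in Ioi y, f u := by
    funext y
    rw [← integral_add_compl (measurableSet_Iic (a := y)) hi, compl_Iic]
    ring
  rw [h]
  have := ((aecover_Ioi (μ := volume) tendsto_id).integral_tendsto_of_countably_generated hi).const_sub
    (∫ u, f u)
  simpa using this

theorem strictMono_integral_Iic (hc : Continuous f) (hi : Integrable f) (hpos : ∀ x, 0 < f x) :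
    StrictMono fun y => ∫ u in Iic y, f u :=
  strictMono_of_hasDerivAt_pos (integral_Iic_hasDerivAt hc hi) hpos

theorem integral_Iic_mem_Ioo (hc : Continuous f) (hi : Integrable f) (hpos : ∀ x, 0 < f x)
    (hone : ∫ u, f u = 1) (x : ℝ) : ∫ u in Iic x, f u ∈ Ioo (0 : ℝ) 1 := by
  have hm := strictMono_integral_Iic hc hi hpos
  have h0 := hm.monotone.le_of_tendsto (tendsto_integral_Iic_atBot hi) (x - 1)
  have h1 := hm.monotone.ge_of_tendsto (tendsto_integral_Iic_atTop hi) (x + 1)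
  rw [hone] at h1
  exact ⟨h0.trans_lt (hm (sub_one_lt x)), (hm (lt_add_one x)).trans_le h1⟩

end Density

/-- If the ratio of the densities `A' / B'` is strictly increasing and `A - B` vanishes at both
ends, then `A < B` everywhere. -/
theorem lt_of_strictMono_deriv_ratio {A B p r : ℝ → ℝ}
    (hA : ∀ x, HasDerivAt A (p x * r x) x) (hB : ∀ x, HasDerivAt B (p x) x)
    (hp : ∀ x, 0 < p x) (hr : StrictMono r)
    (hbot : Tendsto (fun x => A x - B x) atBot (𝓝 0))
    (htop : Tendsto (fun x => A x - B x) atTop (𝓝 0)) (x : ℝ) : A x < B x := by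
  have hD : ∀ y, HasDerivAt (fun x => A x - B x) (p y * (r y - 1)) y := fun y =>
    ((hA y).sub (hB y)).congr_deriv (by ring)
  have hcont : Continuous fun x => A x - B x :=
    continuous_iff_continuousAt.2 fun y => (hD y).continuousAt
  rcases le_total (r x) 1 with h | h
  · have hanti : StrictAntiOn (fun x => A x - B x) (Iic x) := by
      refine strictAntiOn_of_deriv_neg (convex_Iic x) hcont.continuousOn fun y hy => ?_
      rw [interior_Iic] at hy
      rw [(hD y).deriv]
      exact mul_neg_of_pos_of_neg (hp y) (by linarith [hr hy])
    have h1 : A (x - 1) - B (x - 1) ≤ 0 := by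
      refine ge_of_tendsto hbot ?_
      filter_upwards [eventually_le_atBot (x - 1)] with y hy
      exact hanti.antitoneOn (by simp; linarith) (by simp) hy
    have h2 := hanti (show x - 1 ∈ Iic x by simp) (show x ∈ Iic x by simp) (by linarith)
    simp only at h2
    linarith
  · have hmono : StrictMonoOn (fun x => A x - B x) (Ici x) := by
      refine strictMonoOn_of_deriv_pos (convex_Ici x) hcont.continuousOn fun y hy => ?_
      rw [interior_Ici] at hy
      rw [(hD y).deriv]
      exact mul_pos (hp y) (by linarith [hr hy])
    have h1 : A (x + 1) - B (x + 1) ≤ 0 := by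
      refine ge_of_tendsto htop ?_
      filter_upwards [eventually_ge_atTop (x + 1)] with y hy
      exact hmono.monotoneOn (by simp) (by simp; linarith) hy
    have h2 := hmono (show x ∈ Ici x by simp) (show x + 1 ∈ Ici x by simp) (by linarith)
    simp only at h2
    linarith

theorem stdphi_pos (x : ℝ) : 0 < stdphi x := by unfold stdphi; positivity

theorem continuous_stdphi : Continuous stdphi := by unfold stdphi; fun_prop

theorem stdphi_eq_gaussianPDFReal : stdphi = gaussianPDFReal 0 1 := by
  funext x
  simp [stdphi, gaussianPDFReal, div_eq_inv_mul]

theorem integrable_stdphi : Integrable stdphi :=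
  stdphi_eq_gaussianPDFReal ▸ integrable_gaussianPDFReal 0 1

theorem integral_stdphi : ∫ x, stdphi x = 1 :=
  stdphi_eq_gaussianPDFReal ▸ integral_gaussianPDFReal_eq_one 0 one_ne_zero

theorem hasDerivAt_stdphi (x : ℝ) : HasDerivAt stdphi (-x * stdphi x) x := by
  have h : HasDerivAt (fun x : ℝ => -(x ^ 2) / 2) (-x) x :=
    ((hasDerivAt_pow 2 x).neg.div_const 2).congr_deriv (by push_cast; ring)
  exact (h.exp.div_const √(2 * Real.pi)).congr_deriv (by unfold stdphi; ring)

theorem hasDerivAt_stdPhi (x : ℝ) : HasDerivAt stdPhi (stdphi x) x :=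
  integral_Iic_hasDerivAt continuous_stdphi integrable_stdphi x

theorem continuous_stdPhi : Continuous stdPhi :=
  continuous_iff_continuousAt.2 fun x => (hasDerivAt_stdPhi x).continuousAt

theorem strictMono_stdPhi : StrictMono stdPhi :=
  strictMono_integral_Iic continuous_stdphi integrable_stdphi stdphi_pos

theorem tendsto_stdPhi_atBot : Tendsto stdPhi atBot (𝓝 0) :=
  tendsto_integral_Iic_atBot integrable_stdphi

theorem tendsto_stdPhi_atTop : Tendsto stdPhi atTop (𝓝 1) :=
  integral_stdphi ▸ tendsto_integral_Iic_atTop integrable_stdphi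

theorem stdPhi_mem_Ioo (x : ℝ) : stdPhi x ∈ Ioo (0 : ℝ) 1 :=
  integral_Iic_mem_Ioo continuous_stdphi integrable_stdphi stdphi_pos integral_stdphi x

theorem stdPhi_neg (x : ℝ) : stdPhi (-x) = 1 - stdPhi x := by
  have h := integral_comp_neg_Iic (-x) stdphi
  have he : ∀ u, stdphi (-u) = stdphi u := fun u => by simp [stdphi]
  simp only [he, neg_neg] at h
  have h2 := integral_add_compl (measurableSet_Iic (a := x)) integrable_stdphi
  rw [compl_Iic, integral_stdphi] at h2
  unfold stdPhi
  linarith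

theorem stdPhiInv_stdPhi (x : ℝ) : stdPhiInv (stdPhi x) = x :=
  Function.leftInverse_invFun strictMono_stdPhi.injective x

theorem stdPhi_stdPhiInv {q : ℝ} (hq : q ∈ Ioo (0 : ℝ) 1) : stdPhi (stdPhiInv q) = q := by
  refine Function.invFun_eq ?_
  obtain ⟨y, hy⟩ := (tendsto_stdPhi_atBot.eventually_lt_const hq.1).exists
  obtain ⟨z, hz⟩ := (tendsto_stdPhi_atTop.eventually_const_lt hq.2).exists
  exact mem_range_of_exists_le_of_exists_ge continuous_stdPhi ⟨y, hy.le⟩ ⟨z, hz.le⟩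

theorem strictMonoOn_stdPhiInv : StrictMonoOn stdPhiInv (Ioo 0 1) := fun p hp q hq h => by
  rwa [← strictMono_stdPhi.lt_iff_lt, stdPhi_stdPhiInv hp, stdPhi_stdPhiInv hq]

theorem hasDerivAt_stdPhiInv {q : ℝ} (hq : q ∈ Ioo (0 : ℝ) 1) :
    HasDerivAt stdPhiInv (stdphi (stdPhiInv q))⁻¹ q := by
  have hn : Ioo (0 : ℝ) 1 ∈ 𝓝 q := isOpen_Ioo.mem_nhds hq
  refine HasDerivAt.of_local_left_inverse ?_ (hasDerivAt_stdPhi _) (stdphi_pos _).ne' ?_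
  · refine strictMonoOn_stdPhiInv.continuousAt_of_image_mem_nhds hn ?_
    convert univ_mem
    exact eq_univ_of_forall fun x => ⟨stdPhi x, stdPhi_mem_Ioo x, stdPhiInv_stdPhi x⟩
  · filter_upwards [hn] with p hp using stdPhi_stdPhiInv hp

theorem stdPhiInv_one_sub {q : ℝ} (hq : q ∈ Ioo (0 : ℝ) 1) : stdPhiInv (1 - q) = -stdPhiInv q := by
  rw [← stdPhiInv_stdPhi (-stdPhiInv q), stdPhi_neg, stdPhi_stdPhiInv hq]

/-- Strict concavity of the Gaussian isoperimetric profile, as a tangent-line inequality. -/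
theorem stdphi_add_mul_stdPhi_lt {z w : ℝ} (h : w ≠ z) :
    stdphi w + z * stdPhi w < stdphi z + z * stdPhi z := by
  have hD : ∀ y, HasDerivAt (fun y => stdphi y + z * stdPhi y) ((z - y) * stdphi y) y := fun y =>
    ((hasDerivAt_stdphi y).add ((hasDerivAt_stdPhi y).const_mul z)).congr_deriv (by ring)
  have hcont : Continuous fun y => stdphi y + z * stdPhi y :=
    continuous_iff_continuousAt.2 fun y => (hD y).continuousAt
  rcases lt_or_gt_of_ne h with h | h
  · refine (strictMonoOn_of_deriv_pos (convex_Iic z) hcont.continuousOn fun y hy => ?_) h.le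
      (le_refl z) h
    rw [interior_Iic] at hy
    rw [(hD y).deriv]
    exact mul_pos (sub_pos.2 hy) (stdphi_pos y)
  · refine (strictAntiOn_of_deriv_neg (convex_Ici z) hcont.continuousOn fun y hy => ?_)
      (le_refl z) h.le h
    rw [interior_Ici] at hy
    rw [(hD y).deriv]
    exact mul_neg_of_neg_of_pos (sub_neg.2 hy) (stdphi_pos y)

/-- The density of the normal distribution with mean `m` and standard deviation `s`. -/
noncomputable def normalDensity (s m v : ℝ) : ℝ := 1 / s * stdphi ((v - m) / s)

section NormalDensity

variable {s : ℝ}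

theorem normalDensity_pos (hs : 0 < s) (m v : ℝ) : 0 < normalDensity s m v :=
  mul_pos (by positivity) (stdphi_pos _)

theorem continuous_normalDensity (s m : ℝ) : Continuous (normalDensity s m) := by
  unfold normalDensity
  exact continuous_const.mul (continuous_stdphi.comp (by fun_prop))

theorem integrable_normalDensity (hs : 0 < s) (m : ℝ) : Integrable (normalDensity s m) :=
  ((integrable_stdphi.comp_div hs.ne').comp_sub_right m).const_mul (1 / s)

theorem hasDerivAt_stdPhi_sub_div (s m x : ℝ) :
    HasDerivAt (fun v => stdPhi ((v - m) / s)) (normalDensity s m x) x :=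
  ((hasDerivAt_stdPhi _).comp x (((hasDerivAt_id x).sub_const m).div_const s)).congr_deriv
    (by simp [normalDensity, mul_comm])

theorem tendsto_stdPhi_sub_div_atBot (hs : 0 < s) (m : ℝ) :
    Tendsto (fun v => stdPhi ((v - m) / s)) atBot (𝓝 0) :=
  tendsto_stdPhi_atBot.comp
    ((tendsto_atBot_add_const_right atBot (-m) tendsto_id).atBot_div_const hs)

theorem tendsto_stdPhi_sub_div_atTop (hs : 0 < s) (m : ℝ) :
    Tendsto (fun v => stdPhi ((v - m) / s)) atTop (𝓝 1) :=
  tendsto_stdPhi_atTop.comp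
    ((tendsto_atTop_add_const_right atTop (-m) tendsto_id).atTop_div_const hs)

theorem integral_Iic_normalDensity (hs : 0 < s) (m x : ℝ) :
    ∫ v in Iic x, normalDensity s m v = stdPhi ((x - m) / s) := by
  rw [integral_Iic_of_hasDerivAt_of_tendsto
    (hasDerivAt_stdPhi_sub_div s m x).continuousAt.continuousWithinAt
    (fun y _ => hasDerivAt_stdPhi_sub_div s m y) (integrable_normalDensity hs m).integrableOn
    (tendsto_stdPhi_sub_div_atBot hs m), sub_zero]

theorem integral_normalDensity (hs : 0 < s) (m : ℝ) : ∫ v, normalDensity s m v = 1 := by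
  rw [integral_of_hasDerivAt_of_tendsto (fun y => hasDerivAt_stdPhi_sub_div s m y)
    (integrable_normalDensity hs m) (tendsto_stdPhi_sub_div_atBot hs m)
    (tendsto_stdPhi_sub_div_atTop hs m), sub_zero]

theorem stdPhiE_eq_integral (hs : 0 < s) (c : EReal) (m : ℝ) :
    stdPhiE c m s = ∫ v in {v : ℝ | (v : EReal) < c}, normalDensity s m v := by
  induction c with
  | bot => simp [stdPhiE]
  | top => simp [stdPhiE, EReal.coe_lt_top, integral_normalDensity hs]
  | coe r =>
    have h : {v : ℝ | (v : EReal) < (r : EReal)} = Iio r := by ext; simp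
    rw [h, ← integral_Iic_eq_integral_Iio, integral_Iic_normalDensity hs]
    simp [stdPhiE]

end NormalDensity

/-- Lebesgue measure on the (disjoint) union of the intervals with endpoints `a i` and `b i`. -/
noncomputable def truncMeasure {k : ℕ} (a b : Fin k → EReal) : Measure ℝ :=
  ∑ i, volume.restrict ({v : ℝ | (v : EReal) < b i} \ {v : ℝ | (v : EReal) < a i})

theorem measurableSet_coe_lt (c : EReal) : MeasurableSet {v : ℝ | (v : EReal) < c} :=
  measurable_coe_real_ereal measurableSet_Iio

section TruncMeasure

variable {k : ℕ} (a b : Fin k → EReal)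

instance : SFinite (truncMeasure a b) := by
  rw [truncMeasure, ← Measure.sum_fintype]
  infer_instance

theorem truncMeasure_absolutelyContinuous : truncMeasure a b ≪ volume := fun s hs => by
  simp only [truncMeasure, Measure.coe_finsetSum, Finset.sum_apply]
  exact Finset.sum_eq_zero fun i _ => Measure.absolutelyContinuous_restrict hs

theorem MeasureTheory.Integrable.truncMeasure {f : ℝ → ℝ} (hf : Integrable f) :
    Integrable f (truncMeasure a b) :=
  integrable_finsetSum_measure.2 fun _ _ => hf.restrict

variable {a b}

theorem truncMeasure_ne_zero {a b : Fin (k + 1) → EReal} (h : a 0 < b 0) :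
    truncMeasure a b ≠ 0 := fun h0 => by
  obtain ⟨r, har, hrb⟩ := EReal.lt_iff_exists_real_btwn.1 h
  obtain ⟨t, hrt, htb⟩ := EReal.lt_iff_exists_real_btwn.1 hrb
  have h1 : truncMeasure a b (Ioo r t) = 0 := by simp [h0]
  simp only [truncMeasure, Measure.coe_finsetSum, Finset.sum_apply, Finset.sum_eq_zero_iff] at h1
  have h2 := h1 0 (Finset.mem_univ _)
  rw [Measure.restrict_apply measurableSet_Ioo, inter_eq_left.2] at h2
  · simp only [Real.volume_Ioo, ENNReal.ofReal_eq_zero] at h2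
    exact absurd (EReal.coe_lt_coe_iff.1 hrt) (by linarith)
  · rintro v ⟨hrv, hvt⟩
    refine ⟨(EReal.coe_lt_coe_iff.2 hvt).trans htb, ?_⟩
    exact fun hva => lt_asymm hva (har.trans (EReal.coe_lt_coe_iff.2 hrv))

theorem truncSum_eq_integral (hab : ∀ i, a i < b i) {s : ℝ} (hs : 0 < s) (m : ℝ) :
    truncSum a b s m = ∫ v, normalDensity s m v ∂truncMeasure a b := by
  have hi := integrable_normalDensity hs m
  rw [truncMeasure, integral_finsetSum_measure fun _ _ => hi.restrict, truncSum]
  refine Finset.sum_congr rfl fun i _ => ?_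
  have hsub : {v : ℝ | (v : EReal) < a i} ⊆ {v : ℝ | (v : EReal) < b i} :=
    fun v hv => lt_trans hv (hab i)
  rw [setIntegral_sdiff (measurableSet_coe_lt _) hi.integrableOn hsub, stdPhiE_eq_integral hs,
    stdPhiE_eq_integral hs]

end TruncMeasure

theorem integral_pos_of_ae_pos {ν : Measure ℝ} (hν : ν ≠ 0) {g : ℝ → ℝ} (hi : Integrable g ν)
    (hg : ∀ᵐ v ∂ν, 0 < g v) : 0 < ∫ v, g v ∂ν := by
  rw [integral_pos_iff_support_of_nonneg_ae (hg.mono fun _ h => h.le) hi, pos_iff_ne_zero]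
  intro h0
  refine hν (Measure.measure_univ_eq_zero.1 ?_)
  rw [← nonpos_iff_eq_zero, ← h0]
  refine measure_mono_ae ?_
  filter_upwards [hg] with v hv _ using hv.ne'

theorem truncSum_pos {k : ℕ} {a b : Fin (k + 1) → EReal} (hab : ∀ i, a i < b i) {s : ℝ}
    (hs : 0 < s) (m : ℝ) : 0 < truncSum a b s m := by
  rw [truncSum_eq_integral hab hs]
  exact integral_pos_of_ae_pos (truncMeasure_ne_zero (hab 0))
    ((integrable_normalDensity hs m).truncMeasure a b) (ae_of_all _ (normalDensity_pos hs m))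

theorem continuous_truncSum {k : ℕ} (a b : Fin k → EReal) (s : ℝ) :
    Continuous (truncSum a b s) := by
  have h : ∀ c, Continuous fun x => stdPhiE c x s := fun c => by
    unfold stdPhiE
    split_ifs
    · exact continuous_const
    · exact continuous_const
    · exact continuous_stdPhi.comp (by fun_prop)
  unfold truncSum
  exact continuous_finsetSum _ fun i _ => (h (b i)).sub (h (a i))

section Mixture

variable {ν : Measure ℝ} {w m : ℝ → ℝ} {c : ℝ}

theorem integrable_prod_mixture (hw : Integrable w ν) (hm : Continuous m) (hc : 0 < c) :
    Integrable (fun p : ℝ × ℝ => w p.1 * normalDensity c (m p.1) p.2) (ν.prod volume) := by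
  have hmeas : AEStronglyMeasurable (fun p : ℝ × ℝ => w p.1 * normalDensity c (m p.1) p.2)
      (ν.prod volume) := by
    refine hw.aestronglyMeasurable.comp_fst.mul (Continuous.aestronglyMeasurable ?_)
    unfold normalDensity
    exact continuous_const.mul (continuous_stdphi.comp (by fun_prop))
  rw [integrable_prod_iff hmeas]
  refine ⟨ae_of_all _ fun v => (integrable_normalDensity hc (m v)).const_mul (w v), ?_⟩
  refine hw.norm.congr (ae_of_all _ fun v => ?_)
  simp only [norm_mul, integral_const_mul, Real.norm_of_nonneg (normalDensity_pos hc _ _).le,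
    integral_normalDensity hc, mul_one]

variable [SFinite ν]

theorem integrable_mixture (hw : Integrable w ν) (hm : Continuous m) (hc : 0 < c) :
    Integrable fun u => ∫ v, w v * normalDensity c (m v) u ∂ν :=
  (integrable_prod_mixture hw hm hc).integral_prod_right

theorem setIntegral_mixture (hw : Integrable w ν) (hm : Continuous m) (hc : 0 < c) (A : Set ℝ) :
    ∫ u in A, ∫ v, w v * normalDensity c (m v) u ∂ν =
      ∫ v, w v * (∫ u in A, normalDensity c (m v) u) ∂ν := by
  rw [← integral_integral_swap (f := fun v u => w v * normalDensity c (m v) u)]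
  · simp only [integral_const_mul]
  · exact (integrable_prod_mixture hw hm hc).mono_measure
      (Measure.prod_mono le_rfl Measure.restrict_le_self)

theorem integral_mixture (hw : Integrable w ν) (hm : Continuous m) (hc : 0 < c) :
    ∫ u, ∫ v, w v * normalDensity c (m v) u ∂ν = ∫ v, w v ∂ν := by
  have h := setIntegral_mixture hw hm hc univ
  simpa only [Measure.restrict_univ, integral_normalDensity hc, mul_one] using h

/-- A non-degenerate location mixture of normal laws with standard deviation `c` satisfies
`c f < φ(Φ⁻¹(F))`. -/
theorem mixture_density_lt (hν : ν ≠ 0) (hac : ν ≪ volume) (hw : Integrable w ν)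
    (hwpos : ∀ v, 0 < w v) (hone : ∫ v, w v ∂ν = 1) (hm : Continuous m)
    (hinj : Function.Injective m) (hc : 0 < c) {x z : ℝ}
    (hz : stdPhi z = ∫ u in Iic x, ∫ v, w v * normalDensity c (m v) u ∂ν) :
    c * ∫ v, w v * normalDensity c (m v) x ∂ν < stdphi z := by
  simp only [setIntegral_mixture hw hm hc, integral_Iic_normalDensity hc] at hz
  have hphi : Integrable (fun v => w v * stdphi ((x - m v) / c)) ν := by
    refine hw.mul_bdd (c := stdphi 0)
      (continuous_stdphi.comp (by fun_prop)).aestronglyMeasurable (ae_of_all _ fun v => ?_)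
    rw [Real.norm_of_nonneg (stdphi_pos _).le]
    unfold stdphi
    refine div_le_div_of_nonneg_right (Real.exp_le_exp.2 ?_) (by positivity)
    nlinarith [sq_nonneg ((x - m v) / c)]
  have hPhi : Integrable (fun v => w v * stdPhi ((x - m v) / c)) ν := by
    refine hw.mul_bdd (c := 1)
      (continuous_stdPhi.comp (by fun_prop)).aestronglyMeasurable (ae_of_all _ fun v => ?_)
    rw [Real.norm_of_nonneg (stdPhi_mem_Ioo _).1.le]
    exact (stdPhi_mem_Ioo _).2.le
  have hne : ∀ᵐ v ∂ν, (x - m v) / c ≠ z := by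
    refine hac.ae_le ?_
    have hs : {v | (x - m v) / c = z}.Subsingleton := fun u hu v hv => by
      have := hu.trans hv.symm
      rw [div_left_inj' hc.ne', sub_right_inj] at this
      exact hinj this
    refine measure_mono_null (fun v hv => ?_) (hs.measure_zero volume)
    simpa using hv
  have hpos := integral_pos_of_ae_pos hν
    (((hw.mul_const (stdphi z + z * stdPhi z)).sub hphi).sub (hPhi.const_mul z)) (by
      filter_upwards [hne] with v hv
      have := mul_pos (hwpos v) (sub_pos.2 (stdphi_add_mul_stdPhi_lt hv))
      simp only [Pi.sub_apply]
      linarith)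
  rw [integral_sub' ((hw.mul_const _).sub hphi) (hPhi.const_mul z),
    integral_sub' (hw.mul_const _) hphi, integral_mul_const, integral_const_mul, hone, ← hz] at hpos
  have he : c * ∫ v, w v * normalDensity c (m v) x ∂ν = ∫ v, w v * stdphi ((x - m v) / c) ∂ν := by
    rw [← integral_const_mul]
    congr with v
    unfold normalDensity
    field_simp
  linarith

end Mixture

/-- Completing the square: the joint density of `(X, X + U)` factors through the marginal density
of `X + U` and the conditional density of `X`. -/
theorem normalDensity_mul_normalDensity {σ τ : ℝ} (hσ : 0 < σ) (hτ : 0 < τ) (μ u v : ℝ) :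
    normalDensity σ μ u * normalDensity τ u v =
      normalDensity √(σ ^ 2 + τ ^ 2) μ v * normalDensity (σ * τ / √(σ ^ 2 + τ ^ 2))
        (μ + σ ^ 2 / (σ ^ 2 + τ ^ 2) * (v - μ)) u := by
  have hs : 0 < √(σ ^ 2 + τ ^ 2) := by positivity
  have hs2 : √(σ ^ 2 + τ ^ 2) ^ 2 = σ ^ 2 + τ ^ 2 := Real.sq_sqrt (by positivity)
  set s := √(σ ^ 2 + τ ^ 2)
  rw [← hs2]
  have hphi : ∀ x y x' y' : ℝ, x ^ 2 + y ^ 2 = x' ^ 2 + y' ^ 2 →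
      stdphi x * stdphi y = stdphi x' * stdphi y' := fun x y x' y' h => by
    simp only [stdphi, div_mul_div_comm, ← Real.exp_add]
    congr 2
    linarith
  have hsq := hphi ((u - μ) / σ) ((v - u) / τ) ((v - μ) / s)
    ((u - (μ + σ ^ 2 / s ^ 2 * (v - μ))) / (σ * τ / s)) (by
      field_simp
      rw [hs2]
      ring)
  simp only [normalDensity]
  rw [mul_mul_mul_comm, hsq, mul_mul_mul_comm (1 / s)]
  congr 1
  field_simp

section CondPDF

variable {k : ℕ} {a b : Fin (k + 1) → EReal} {σ τ : ℝ}

theorem condPDF_eq_integral (hab : ∀ i, a i < b i) (hσ : 0 < σ) (hτ : 0 < τ) (μ u : ℝ) :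
    condPDF a b σ τ μ u =
      ∫ v, normalDensity √(σ ^ 2 + τ ^ 2) μ v / truncSum a b √(σ ^ 2 + τ ^ 2) μ *
        normalDensity (σ * τ / √(σ ^ 2 + τ ^ 2)) (μ + σ ^ 2 / (σ ^ 2 + τ ^ 2) * (v - μ)) u
        ∂truncMeasure a b := by
  have h : condPDF a b σ τ μ u =
      normalDensity σ μ u * truncSum a b τ u / truncSum a b √(σ ^ 2 + τ ^ 2) μ := rfl
  rw [h, truncSum_eq_integral hab hτ, ← integral_const_mul, ← integral_div]
  congr with v
  rw [normalDensity_mul_normalDensity hσ hτ]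
  ring

theorem integrable_weight {s : ℝ} (hs : 0 < s) (μ : ℝ) :
    Integrable (fun v => normalDensity s μ v / truncSum a b s μ) (truncMeasure a b) :=
  ((integrable_normalDensity hs μ).truncMeasure a b).div_const _

theorem integral_weight (hab : ∀ i, a i < b i) {s : ℝ} (hs : 0 < s) (μ : ℝ) :
    ∫ v, normalDensity s μ v / truncSum a b s μ ∂truncMeasure a b = 1 := by
  rw [integral_div, ← truncSum_eq_integral hab hs, div_self (truncSum_pos hab hs μ).ne']

theorem condPDF_pos (hab : ∀ i, a i < b i) (hσ : 0 < σ) (hτ : 0 < τ) (μ x : ℝ) :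
    0 < condPDF a b σ τ μ x :=
  div_pos (mul_pos (normalDensity_pos hσ μ x) (truncSum_pos hab hτ x))
    (truncSum_pos hab (by positivity) μ)

theorem continuous_condPDF (a b : Fin (k + 1) → EReal) (σ τ μ : ℝ) :
    Continuous (condPDF a b σ τ μ) :=
  ((continuous_normalDensity σ μ).mul (continuous_truncSum a b τ)).div_const _

theorem integrable_condPDF (hab : ∀ i, a i < b i) (hσ : 0 < σ) (hτ : 0 < τ) (μ : ℝ) :
    Integrable (condPDF a b σ τ μ) := by
  rw [funext (condPDF_eq_integral hab hσ hτ μ)]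
  exact integrable_mixture (integrable_weight (by positivity) μ) (by fun_prop) (by positivity)

theorem integral_condPDF (hab : ∀ i, a i < b i) (hσ : 0 < σ) (hτ : 0 < τ) (μ : ℝ) :
    ∫ x, condPDF a b σ τ μ x = 1 := by
  rw [funext (condPDF_eq_integral hab hσ hτ μ), integral_mixture
    (integrable_weight (by positivity) μ) (by fun_prop) (by positivity),
    integral_weight hab (by positivity)]

theorem Fmu_mem_Ioo (hab : ∀ i, a i < b i) (hσ : 0 < σ) (hτ : 0 < τ) (μ x : ℝ) :
    Fmu a b σ τ μ x ∈ Ioo (0 : ℝ) 1 :=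
  integral_Iic_mem_Ioo (continuous_condPDF a b σ τ μ) (integrable_condPDF hab hσ hτ μ)
    (condPDF_pos hab hσ hτ μ) (integral_condPDF hab hσ hτ μ) x

theorem hasDerivAt_Fmu (hab : ∀ i, a i < b i) (hσ : 0 < σ) (hτ : 0 < τ) (μ x : ℝ) :
    HasDerivAt (Fmu a b σ τ μ) (condPDF a b σ τ μ x) x :=
  integral_Iic_hasDerivAt (continuous_condPDF a b σ τ μ) (integrable_condPDF hab hσ hτ μ) x

theorem tendsto_Fmu_atBot (hab : ∀ i, a i < b i) (hσ : 0 < σ) (hτ : 0 < τ) (μ : ℝ) :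
    Tendsto (Fmu a b σ τ μ) atBot (𝓝 0) :=
  tendsto_integral_Iic_atBot (integrable_condPDF hab hσ hτ μ)

theorem tendsto_Fmu_atTop (hab : ∀ i, a i < b i) (hσ : 0 < σ) (hτ : 0 < τ) (μ : ℝ) :
    Tendsto (Fmu a b σ τ μ) atTop (𝓝 1) :=
  integral_condPDF hab hσ hτ μ ▸ tendsto_integral_Iic_atTop (integrable_condPDF hab hσ hτ μ)

theorem condPDF_lt (hab : ∀ i, a i < b i) (hσ : 0 < σ) (hτ : 0 < τ) (μ x : ℝ) :
    σ * τ / √(σ ^ 2 + τ ^ 2) * condPDF a b σ τ μ x <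
      stdphi (stdPhiInv (Fmu a b σ τ μ x)) := by
  have hs : 0 < √(σ ^ 2 + τ ^ 2) := by positivity
  rw [condPDF_eq_integral hab hσ hτ]
  refine mixture_density_lt (x := x) (truncMeasure_ne_zero (hab 0))
    (truncMeasure_absolutelyContinuous a b) (integrable_weight hs μ)
    (fun v => div_pos (normalDensity_pos hs μ v) (truncSum_pos hab hs μ))
    (integral_weight hab hs μ) (by fun_prop) (fun u v huv => ?_) (by positivity) ?_
  · have : σ ^ 2 / (σ ^ 2 + τ ^ 2) ≠ 0 := by positivity
    simpa [this, hσ.ne'] using mul_left_cancel₀ this (add_left_cancel huv)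
  · rw [stdPhi_stdPhiInv (Fmu_mem_Ioo hab hσ hτ μ x), Fmu]
    simp only [condPDF_eq_integral hab hσ hτ]

theorem hasDerivAt_stdPhiInv_Fmu (hab : ∀ i, a i < b i) (hσ : 0 < σ) (hτ : 0 < τ) (μ x : ℝ) :
    HasDerivAt (fun x => stdPhiInv (Fmu a b σ τ μ x))
      (condPDF a b σ τ μ x / stdphi (stdPhiInv (Fmu a b σ τ μ x))) x :=
  ((hasDerivAt_stdPhiInv (Fmu_mem_Ioo hab hσ hτ μ x)).comp x
    (hasDerivAt_Fmu hab hσ hτ μ x)).congr_deriv (by rw [div_eq_inv_mul])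

theorem strictMono_sub_mul_stdPhiInv_Fmu (hab : ∀ i, a i < b i) (hσ : 0 < σ) (hτ : 0 < τ)
    (μ : ℝ) :
    StrictMono fun x => x - σ * τ / √(σ ^ 2 + τ ^ 2) * stdPhiInv (Fmu a b σ τ μ x) := by
  refine strictMono_of_hasDerivAt_pos (fun x => (hasDerivAt_id x).sub
    ((hasDerivAt_stdPhiInv_Fmu hab hσ hτ μ x).const_mul _)) fun x => ?_
  rw [sub_pos, ← mul_div_assoc, div_lt_one (stdphi_pos _)]
  exact condPDF_lt hab hσ hτ μ x

theorem tendsto_stdPhiInv_Fmu_atBot (hab : ∀ i, a i < b i) (hσ : 0 < σ) (hτ : 0 < τ) (μ : ℝ) :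
    Tendsto (fun x => stdPhiInv (Fmu a b σ τ μ x)) atBot atBot := by
  refine tendsto_atBot.2 fun y => ?_
  filter_upwards [(tendsto_Fmu_atBot hab hσ hτ μ).eventually_lt_const (stdPhi_mem_Ioo y).1]
    with x hx
  rw [← stdPhiInv_stdPhi y]
  exact (strictMonoOn_stdPhiInv (Fmu_mem_Ioo hab hσ hτ μ x) (stdPhi_mem_Ioo y) hx).le

theorem tendsto_stdPhiInv_Fmu_atTop (hab : ∀ i, a i < b i) (hσ : 0 < σ) (hτ : 0 < τ) (μ : ℝ) :
    Tendsto (fun x => stdPhiInv (Fmu a b σ τ μ x)) atTop atTop := by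
  refine tendsto_atTop.2 fun y => ?_
  filter_upwards [(tendsto_Fmu_atTop hab hσ hτ μ).eventually_const_lt (stdPhi_mem_Ioo y).2]
    with x hx
  rw [← stdPhiInv_stdPhi y]
  exact (strictMonoOn_stdPhiInv (stdPhi_mem_Ioo y) (Fmu_mem_Ioo hab hσ hτ μ x) hx).le

/-- The family `condPDF a b σ τ μ` is an exponential family in `μ`. -/
theorem exists_condPDF_eq_exp_mul (hab : ∀ i, a i < b i) (hσ : 0 < σ) (μ₁ μ₂ : ℝ) :
    ∃ C > 0, ∀ x, condPDF a b σ τ μ₂ x =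
      C * Real.exp ((μ₂ - μ₁) / σ ^ 2 * x) * condPDF a b σ τ μ₁ x := by
  have hs : 0 < √(σ ^ 2 + τ ^ 2) := by positivity
  have h1 := truncSum_pos hab hs μ₁
  have h2 := truncSum_pos hab hs μ₂
  refine ⟨Real.exp ((μ₁ ^ 2 - μ₂ ^ 2) / (2 * σ ^ 2)) *
    (truncSum a b √(σ ^ 2 + τ ^ 2) μ₁ / truncSum a b √(σ ^ 2 + τ ^ 2) μ₂), by positivity,
    fun x => ?_⟩
  have he : stdphi ((x - μ₂) / σ) = Real.exp ((μ₁ ^ 2 - μ₂ ^ 2) / (2 * σ ^ 2)) *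
      Real.exp ((μ₂ - μ₁) / σ ^ 2 * x) * stdphi ((x - μ₁) / σ) := by
    unfold stdphi
    rw [← mul_div_assoc, ← Real.exp_add, ← Real.exp_add]
    congr 2
    field_simp
    ring
  unfold condPDF
  rw [he]
  field_simp

theorem Fmu_lt_stdPhi (hab : ∀ i, a i < b i) (hσ : 0 < σ) (hτ : 0 < τ) {μ₁ μ₂ : ℝ}
    (hμ : μ₁ < μ₂) (x : ℝ) :
    Fmu a b σ τ μ₂ x < stdPhi (stdPhiInv (Fmu a b σ τ μ₁ x) -
      (μ₂ - μ₁) / σ ^ 2 * (σ * τ / √(σ ^ 2 + τ ^ 2))) := by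
  obtain ⟨C, hC, hexp⟩ := exists_condPDF_eq_exp_mul (τ := τ) hab hσ μ₁ μ₂
  have hmono := strictMono_sub_mul_stdPhiInv_Fmu hab hσ hτ μ₁
  set c := σ * τ / √(σ ^ 2 + τ ^ 2)
  have htpos : 0 < (μ₂ - μ₁) / σ ^ 2 := div_pos (sub_pos.2 hμ) (by positivity)
  set t := (μ₂ - μ₁) / σ ^ 2
  clear_value c t
  refine lt_of_strictMono_deriv_ratio (A := Fmu a b σ τ μ₂)
    (B := fun x => stdPhi (stdPhiInv (Fmu a b σ τ μ₁ x) - t * c))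
    (p := fun x => stdphi (stdPhiInv (Fmu a b σ τ μ₁ x) - t * c) *
      (condPDF a b σ τ μ₁ x / stdphi (stdPhiInv (Fmu a b σ τ μ₁ x))))
    (r := fun x => C * Real.exp ((t * c) ^ 2 / 2) *
      Real.exp (t * (x - c * stdPhiInv (Fmu a b σ τ μ₁ x))))
    (fun y => (hasDerivAt_Fmu hab hσ hτ μ₂ y).congr_deriv ?_)
    (fun y => (hasDerivAt_stdPhi _).comp y
      ((hasDerivAt_stdPhiInv_Fmu hab hσ hτ μ₁ y).sub_const _))
    (fun y => mul_pos (stdphi_pos _) (div_pos (condPDF_pos hab hσ hτ μ₁ y) (stdphi_pos _)))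
    (fun y z hyz => ?_) ?_ ?_ x
  · rw [hexp]
    generalize stdPhiInv (Fmu a b σ τ μ₁ y) = z
    have he : stdphi (z - t * c) * Real.exp ((t * c) ^ 2 / 2) * Real.exp (t * (y - c * z)) =
        Real.exp (t * y) * stdphi z := by
      unfold stdphi
      rw [div_mul_eq_mul_div, div_mul_eq_mul_div, ← mul_div_assoc, ← Real.exp_add,
        ← Real.exp_add, ← Real.exp_add]
      congr 2
      ring
    have hz := (stdphi_pos z).ne'
    generalize condPDF a b σ τ μ₁ y = g
    calc C * Real.exp (t * y) * g = C * g * (Real.exp (t * y) * stdphi z) / stdphi z := by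
          field_simp
      _ = _ := by
          rw [← he]
          ring
  · exact mul_lt_mul_of_pos_left
      (Real.exp_lt_exp.2 (mul_lt_mul_of_pos_left (hmono hyz) htpos)) (by positivity)
  · simpa [sub_eq_add_neg] using (tendsto_Fmu_atBot hab hσ hτ μ₂).sub (tendsto_stdPhi_atBot.comp
      (tendsto_atBot_add_const_right atBot (-(t * c)) (tendsto_stdPhiInv_Fmu_atBot hab hσ hτ μ₁)))
  · simpa [sub_eq_add_neg] using (tendsto_Fmu_atTop hab hσ hτ μ₂).sub (tendsto_stdPhi_atTop.comp
      (tendsto_atTop_add_const_right atTop (-(t * c)) (tendsto_stdPhiInv_Fmu_atTop hab hσ hτ μ₁)))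

theorem sub_lt_of_Fmu_eq (hab : ∀ i, a i < b i) (hσ : 0 < σ) (hτ : 0 < τ) {μ₁ μ₂ x q₁ q₂ : ℝ}
    (hq₁ : q₁ ∈ Ioo (0 : ℝ) 1) (hq₂ : q₂ ∈ Ioo (0 : ℝ) 1) (hq : q₁ < q₂)
    (h₁ : Fmu a b σ τ μ₁ x = 1 - q₁) (h₂ : Fmu a b σ τ μ₂ x = 1 - q₂) :
    μ₂ - μ₁ < σ * (stdPhiInv q₂ - stdPhiInv q₁) * (√(σ ^ 2 + τ ^ 2) / τ) := by
  have hinv := sub_pos.2 (strictMonoOn_stdPhiInv hq₁ hq₂ hq)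
  rcases le_or_gt μ₂ μ₁ with h | h
  · have : 0 < σ * (stdPhiInv q₂ - stdPhiInv q₁) * (√(σ ^ 2 + τ ^ 2) / τ) := by positivity
    linarith
  · have hlt := Fmu_lt_stdPhi hab hσ hτ h x
    have hneg : 1 - q₂ = stdPhi (-stdPhiInv q₂) := by rw [stdPhi_neg, stdPhi_stdPhiInv hq₂]
    rw [h₁, h₂, stdPhiInv_one_sub hq₁, hneg, strictMono_stdPhi.lt_iff_lt] at hlt
    have hs : 0 < √(σ ^ 2 + τ ^ 2) := by positivity
    have hd : (μ₂ - μ₁) / σ ^ 2 * (σ * τ / √(σ ^ 2 + τ ^ 2)) < stdPhiInv q₂ - stdPhiInv q₁ := by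
      linarith
    calc μ₂ - μ₁ = σ * ((μ₂ - μ₁) / σ ^ 2 * (σ * τ / √(σ ^ 2 + τ ^ 2))) *
          (√(σ ^ 2 + τ ^ 2) / τ) := by field_simp
      _ < _ := by gcongr

end CondPDF

/-- Data carving interval-length bound: with `σ̃² = σ²/n` and `τ̃² = (σ²/n)(1-δ)/δ`, the
interval length is bounded by `(σ/√n)(Φ⁻¹(q₂) - Φ⁻¹(q₁))/√(1-δ)`. -/
theorem stmt4 {k : ℕ} (a b : Fin (k + 1) → EReal) (hab : truncOrdered a b)
    (σ : ℝ) (hσ : 0 < σ) (n : ℕ) (hn : 0 < n) (δ : ℝ) (hδ : δ ∈ Ioo (0 : ℝ) 1)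
    (σt τt : ℝ) (hσt : σt = σ / Real.sqrt n)
    (hτt : τt = Real.sqrt (σ ^ 2 / n * ((1 - δ) / δ)))
    (μq : ℝ → ℝ → ℝ)
    (hμq : ∀ q ∈ Ioo (0 : ℝ) 1, ∀ x : ℝ, Fmu a b σt τt (μq q x) x = 1 - q)
    (x : ℝ) (q₁ q₂ : ℝ) (hq₁ : q₁ ∈ Ioo (0 : ℝ) 1) (hq₂ : q₂ ∈ Ioo (0 : ℝ) 1)
    (hq : q₁ < q₂) :
    μq q₂ x - μq q₁ x
      < σ / Real.sqrt n * (stdPhiInv q₂ - stdPhiInv q₁) * (1 / Real.sqrt (1 - δ)) := by 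
  obtain ⟨hδ0, hδ1⟩ := hδ
  have hn' : (0 : ℝ) < n := Nat.cast_pos.2 hn
  have h1δ : 0 < 1 - δ := sub_pos.2 hδ1
  have hσt0 : 0 < σt := hσt ▸ by positivity
  have hτt0 : 0 < τt := hτt ▸ by positivity
  have hσt2 : σt ^ 2 = σ ^ 2 / n := by rw [hσt, div_pow, Real.sq_sqrt hn'.le]
  have hτt2 : τt ^ 2 = σt ^ 2 * ((1 - δ) / δ) := by
    rw [hτt, Real.sq_sqrt (by positivity), hσt2]
  have hratio : √(σt ^ 2 + τt ^ 2) / τt = 1 / √(1 - δ) := by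
    rw [← Real.sqrt_sq hτt0.le, ← Real.sqrt_div (by positivity), one_div, ← Real.sqrt_inv,
      Real.sq_sqrt (by positivity), hτt2]
    congr 1
    field_simp
    ring
  rw [← hσt, ← hratio]
  exact sub_lt_of_Fmu_eq hab.1 hσt0 hτt0 hq₁ hq₂ hq (hμq q₁ hq₁ x) (hμq q₂ hq₂ x)
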